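/- arXiv:2208.07628 — 2 statements merged into one kernel-verified Lean document; each statement's English description precedes it below -/
import Mathlib

section
/- (Faithfulness, semantic form.) Let θ be any t-norm and suppose all base membership functions are {0,1}-valued. Define the classical interpretation by A^I = {x ∈ Δ | m_A(x) = 1} and R^I = {(x,y) ∈ Δ × Δ | m_R(x,y) = 1}. Then for all ALC concept descriptions C and D: the fuzzy membership m(x, C ⊓ ¬D) = 0 for every x ∈ Δ if and only if C^I ⊆ D^I under the classical extension; i.e., the TBox loss term of the axiom C ⊑ D vanishes exactly when the axiom holds in the derived classical interpretation. -/
open unitInterval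

/-- A t-norm on the real unit interval: associative, commutative, has `1` as
identity element, and monotone in both arguments. -/
structure Tnorm where
  toFun : I → I → I
  assoc : ∀ x y z, toFun (toFun x y) z = toFun x (toFun y z)
  comm : ∀ x y, toFun x y = toFun y x
  one_id : ∀ x, toFun x 1 = x
  mono : ∀ x x' y y', x ≤ x' → y ≤ y' → toFun x y ≤ toFun x' y'

/-- The dual t-conorm of a t-norm: `κ(x,y) = 1 − θ(1−x, 1−y)`. -/
def Tnorm.conorm (θ : Tnorm) (x y : I) : I := σ (θ.toFun (σ x) (σ y))

/-- A t-norm is strict-at-zero if θ(x,y) = 0 iff x = 0 or y = 0. -/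
def StrictAtZero (θ : Tnorm) : Prop := ∀ x y : I, θ.toFun x y = 0 ↔ x = 0 ∨ y = 0

/-- ALC concept descriptions over concept names `CN` and relation names `RN`. -/
inductive ALC (CN RN : Type) : Type where
  | atom : CN → ALC CN RN
  | inter : ALC CN RN → ALC CN RN → ALC CN RN
  | union : ALC CN RN → ALC CN RN → ALC CN RN
  | compl : ALC CN RN → ALC CN RN
  | ex : RN → ALC CN RN → ALC CN RN
  | all : RN → ALC CN RN → ALC CN RN

variable {CN RN Δ : Type} [Fintype Δ] [Nonempty Δ]

/-- Fuzzy membership `m(x, C)` of `x` in a concept description `C`, given a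
t-norm `θ` and base memberships `mA` (concept names) and `mR` (relation names):
`m(x, A) = mA A x`; `m(x, C ⊓ D) = θ(m(x,C), m(x,D))`;
`m(x, C ⊔ D) = κ(m(x,C), m(x,D))`; `m(x, ¬C) = 1 − m(x,C)`;
`m(x, ∃R.D) = max_{y ∈ Δ} θ(m(y,D), mR R x y)`;
`m(x, ∀R.D) = min_{y ∈ Δ} κ(1 − mR R x y, m(y,D))`. -/
noncomputable def fmem (θ : Tnorm) (mA : CN → Δ → I) (mR : RN → Δ → Δ → I) :
    ALC CN RN → Δ → I
  | .atom A, x => mA A x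
  | .inter C D, x => θ.toFun (fmem θ mA mR C x) (fmem θ mA mR D x)
  | .union C D, x => θ.conorm (fmem θ mA mR C x) (fmem θ mA mR D x)
  | .compl C, x => σ (fmem θ mA mR C x)
  | .ex R D, x => Finset.univ.sup' Finset.univ_nonempty
      (fun y => θ.toFun (fmem θ mA mR D y) (mR R x y))
  | .all R D, x => Finset.univ.inf' Finset.univ_nonempty
      (fun y => θ.conorm (σ (mR R x y)) (fmem θ mA mR D y))

/-- Classical ALC interpretation on Δ: extension of a concept description
from assignments `cI` of subsets of Δ to concept names and `rI` of binary
relations on Δ to relation names. -/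
def interp (cI : CN → Set Δ) (rI : RN → Set (Δ × Δ)) : ALC CN RN → Set Δ
  | .atom A => cI A
  | .inter C D => interp cI rI C ∩ interp cI rI D
  | .union C D => interp cI rI C ∪ interp cI rI D
  | .compl C => (interp cI rI C)ᶜ
  | .ex R D => {x | ∃ y, (x, y) ∈ rI R ∧ y ∈ interp cI rI D}
  | .all R D => {x | ∀ y, (x, y) ∈ rI R → y ∈ interp cI rI D}

theorem Tnorm.zero_right (θ : Tnorm) (x : I) : θ.toFun x 0 = 0 := by
  apply le_antisymm _ unitInterval.nonneg'
  have h := θ.mono x 1 0 0 unitInterval.le_one' le_rfl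
  rwa [θ.comm 1 0, θ.one_id] at h

theorem Tnorm.zero_left (θ : Tnorm) (x : I) : θ.toFun 0 x = 0 := by
  rw [θ.comm, θ.zero_right]

theorem fmem_crisp (θ : Tnorm)
    (mA : CN → Δ → I) (mR : RN → Δ → Δ → I)
    (hA : ∀ A x, mA A x = 0 ∨ mA A x = 1)
    (hR : ∀ R x y, mR R x y = 0 ∨ mR R x y = 1) (C : ALC CN RN) :
    ∀ x : Δ,
      (x ∈ interp (fun A => {x | mA A x = 1}) (fun R => {p | mR R p.1 p.2 = 1}) C ∧
        fmem θ mA mR C x = 1) ∨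
      (x ∉ interp (fun A => {x | mA A x = 1}) (fun R => {p | mR R p.1 p.2 = 1}) C ∧
        fmem θ mA mR C x = 0) := by
  induction C with
  | atom A =>
    intro x
    rcases hA A x with h | h <;> simp [interp, fmem, h]
  | inter C D ihC ihD =>
    intro x
    rcases ihC x with ⟨h1, h2⟩ | ⟨h1, h2⟩ <;> rcases ihD x with ⟨h3, h4⟩ | ⟨h3, h4⟩ <;>
      simp [interp, fmem, h1, h2, h3, h4, θ.zero_right, θ.zero_left, θ.one_id]
  | union C D ihC ihD =>
    intro x
    rcases ihC x with ⟨h1, h2⟩ | ⟨h1, h2⟩ <;> rcases ihD x with ⟨h3, h4⟩ | ⟨h3, h4⟩ <;>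
      simp [interp, fmem, Tnorm.conorm, h1, h2, h3, h4, θ.zero_right, θ.zero_left, θ.one_id]
  | compl C ihC =>
    intro x
    rcases ihC x with ⟨h1, h2⟩ | ⟨h1, h2⟩ <;> simp [interp, fmem, h1, h2]
  | ex R D ih =>
    intro x
    by_cases h : ∃ y, mR R x y = 1 ∧
      y ∈ interp (fun A => {x | mA A x = 1}) (fun R => {p | mR R p.1 p.2 = 1}) D
    · left
      refine ⟨h, ?_⟩
      obtain ⟨y, h1, h2⟩ := h
      have h3 : fmem θ mA mR D y = 1 := by
        rcases ih y with h | h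
        · exact h.2
        · exact absurd h2 h.1
      apply le_antisymm unitInterval.le_one'
      have := Finset.le_sup' (fun y => θ.toFun (fmem θ mA mR D y) (mR R x y))
        (Finset.mem_univ y)
      simp only [h1, h3, θ.one_id] at this
      exact this
    · right
      refine ⟨h, ?_⟩
      apply le_antisymm _ unitInterval.nonneg'
      apply Finset.sup'_le
      intro y _
      rcases hR R x y with h1 | h1
      · rw [h1, θ.zero_right]
      · rcases ih y with h2 | h2
        · exact absurd ⟨y, h1, h2.1⟩ h
        · rw [h2.2, θ.zero_left]
  | all R D ih =>
    intro x
    by_cases h : ∀ y, mR R x y = 1 →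
      y ∈ interp (fun A => {x | mA A x = 1}) (fun R => {p | mR R p.1 p.2 = 1}) D
    · left
      refine ⟨h, ?_⟩
      apply le_antisymm unitInterval.le_one'
      apply Finset.le_inf'
      intro y _
      rcases hR R x y with h1 | h1
      · simp [Tnorm.conorm, h1, θ.zero_left]
      · rcases ih y with h2 | h2
        · simp [Tnorm.conorm, h2.2, θ.zero_right]
        · exact absurd (h y h1) h2.1
    · right
      refine ⟨h, ?_⟩
      push Not at h
      obtain ⟨y, h1, h2⟩ := h
      have h3 : fmem θ mA mR D y = 0 := by
        rcases ih y with h | h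
        · exact absurd h.1 h2
        · exact h.2
      apply le_antisymm _ unitInterval.nonneg'
      have := Finset.inf'_le (fun y => θ.conorm (σ (mR R x y)) (fmem θ mA mR D y))
        (Finset.mem_univ y)
      refine le_trans this ?_
      simp [h1, h3, Tnorm.conorm, θ.one_id]

/-- faithfulness, semantic form: if all base membership
functions are {0,1}-valued, then for all concept descriptions C and D,
m(x, C ⊓ ¬D) = 0 for every x ∈ Δ iff C^I ⊆ D^I in the classical
interpretation derived from the base memberships; i.e. the TBox loss term of
the axiom C ⊑ D vanishes exactly when the axiom holds. -/
theorem faithfulness_semantic (θ : Tnorm)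
    (mA : CN → Δ → I) (mR : RN → Δ → Δ → I)
    (hA : ∀ A x, mA A x = 0 ∨ mA A x = 1)
    (hR : ∀ R x y, mR R x y = 0 ∨ mR R x y = 1) :
    ∀ C D : ALC CN RN,
      (∀ x : Δ, fmem θ mA mR (.inter C (.compl D)) x = 0) ↔
        interp (fun A => {x | mA A x = 1}) (fun R => {p | mR R p.1 p.2 = 1}) C ⊆
          interp (fun A => {x | mA A x = 1}) (fun R => {p | mR R p.1 p.2 = 1}) D := by
  intro C D
  refine forall_congr' fun x => ?_
  rcases fmem_crisp θ mA mR hA hR C x with ⟨h1, h2⟩ | ⟨h1, h2⟩ <;>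
    rcases fmem_crisp θ mA mR hA hR D x with ⟨h3, h4⟩ | ⟨h3, h4⟩ <;>
    simp [fmem, h1, h2, h3, h4, θ.zero_right, θ.zero_left, θ.one_id]
end

section
/- (Representation completeness, semantic form.) Let I be a classical interpretation on the finite nonempty domain Δ, and let θ be any t-norm. Define the base membership functions as the indicator functions m_A(x) = 1 if x ∈ A^I and 0 otherwise, and m_R(x,y) = 1 if (x,y) ∈ R^I and 0 otherwise. Then: (i) for every concept description C and every x ∈ Δ, m(x, C) = 1 if and only if x ∈ C^I; (ii) for every TBox axiom C ⊑ D with C^I ⊆ D^I, m(x, C ⊓ ¬D) = 0 for all x ∈ Δ; (iii) for every ABox assertion C(a) with a ∈ C^I, m(a, C) = 1; and (iv) for every ABox assertion R(a,b) with (a,b) ∈ R^I, m_R(a,b) = 1. Hence every loss term of F-ALCON vanishes on the fuzzy interpretation induced by a finite classical model. -/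
open unitInterval

variable {CN RN Δ : Type} [Fintype Δ] [Nonempty Δ]

open Classical in
/-- Indicator base membership of concept names: m_A(x) = 1 if x ∈ A^I, else 0. -/
noncomputable def indA (cI : CN → Set Δ) (A : CN) (x : Δ) : I :=
  if x ∈ cI A then 1 else 0

open Classical in
/-- Indicator base membership of relation names: m_R(x,y) = 1 if (x,y) ∈ R^I, else 0. -/
noncomputable def indR (rI : RN → Set (Δ × Δ)) (R : RN) (x y : Δ) : I :=
  if (x, y) ∈ rI R then 1 else 0

open Classical in
theorem fmem_eq_ite (θ : Tnorm) (cI : CN → Set Δ) (rI : RN → Set (Δ × Δ)) (C : ALC CN RN) :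
    ∀ x : Δ, fmem θ (indA cI) (indR rI) C x = if x ∈ interp cI rI C then 1 else 0 := by
  induction C with
  | atom A => intro x; by_cases h : x ∈ cI A <;> simp [fmem, interp, indA, h]
  | inter C D hC hD =>
    intro x
    by_cases h1 : x ∈ interp cI rI C <;> by_cases h2 : x ∈ interp cI rI D <;>
      simp [fmem, interp, hC, hD, h1, h2, θ.one_id, θ.zero_left, θ.zero_right]
  | union C D hC hD =>
    intro x
    by_cases h1 : x ∈ interp cI rI C <;> by_cases h2 : x ∈ interp cI rI D <;>
      simp [fmem, interp, Tnorm.conorm, hC, hD, h1, h2, θ.one_id, θ.zero_left, θ.zero_right]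
  | compl C hC =>
    intro x
    by_cases h1 : x ∈ interp cI rI C <;> simp [fmem, interp, hC, h1]
  | ex R D hD =>
    intro x
    have key : ∀ y, θ.toFun (fmem θ (indA cI) (indR rI) D y) (indR rI R x y) =
        if (x, y) ∈ rI R ∧ y ∈ interp cI rI D then 1 else 0 := by
      intro y
      by_cases h1 : (x, y) ∈ rI R <;> by_cases h2 : y ∈ interp cI rI D <;>
        simp [hD, indR, h1, h2, θ.one_id, θ.zero_left, θ.zero_right]
    simp only [fmem, key]
    by_cases h : ∃ y, (x, y) ∈ rI R ∧ y ∈ interp cI rI D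
    · rw [if_pos (show x ∈ interp cI rI (.ex R D) from h)]
      obtain ⟨y, hy⟩ := h
      apply le_antisymm unitInterval.le_one'
      refine le_trans ?_ (Finset.le_sup' _ (Finset.mem_univ y))
      simp [hy]
    · rw [if_neg (show ¬ x ∈ interp cI rI (.ex R D) from h)]
      apply le_antisymm _ unitInterval.nonneg'
      apply Finset.sup'_le
      intro y _
      rw [if_neg (fun hy => h ⟨y, hy⟩)]
  | all R D hD =>
    intro x
    have key : ∀ y, θ.conorm (σ (indR rI R x y)) (fmem θ (indA cI) (indR rI) D y) =
        if (x, y) ∈ rI R → y ∈ interp cI rI D then 1 else 0 := by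
      intro y
      by_cases h1 : (x, y) ∈ rI R <;> by_cases h2 : y ∈ interp cI rI D <;>
        simp [hD, indR, Tnorm.conorm, h1, h2, θ.one_id, θ.zero_left, θ.zero_right]
    simp only [fmem, key]
    by_cases h : ∀ y, (x, y) ∈ rI R → y ∈ interp cI rI D
    · rw [if_pos (show x ∈ interp cI rI (.all R D) from h)]
      apply le_antisymm unitInterval.le_one'
      apply Finset.le_inf'
      intro y _
      rw [if_pos (h y)]
    · rw [if_neg (show ¬ x ∈ interp cI rI (.all R D) from h)]
      apply le_antisymm _ unitInterval.nonneg'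
      obtain ⟨y, hy⟩ := not_forall.mp h
      refine le_trans (Finset.inf'_le _ (Finset.mem_univ y)) ?_
      rw [if_neg hy]

/-- representation completeness, semantic form: for the fuzzy
interpretation induced by a classical interpretation via indicator functions,
(i) m(x, C) = 1 iff x ∈ C^I for every concept description C and x ∈ Δ;
(ii) for every TBox axiom C ⊑ D with C^I ⊆ D^I, m(x, C ⊓ ¬D) = 0 for all x;
(iii) for every ABox assertion C(a) with a ∈ C^I, m(a, C) = 1; and
(iv) for every ABox assertion R(a,b) with (a,b) ∈ R^I, m_R(a,b) = 1.
Hence every loss term of F-ALCON vanishes on this fuzzy interpretation. -/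
theorem representation_completeness (θ : Tnorm)
    (cI : CN → Set Δ) (rI : RN → Set (Δ × Δ)) :
    (∀ (C : ALC CN RN) (x : Δ),
      fmem θ (indA cI) (indR rI) C x = 1 ↔ x ∈ interp cI rI C) ∧
    (∀ C D : ALC CN RN, interp cI rI C ⊆ interp cI rI D →
      ∀ x : Δ, fmem θ (indA cI) (indR rI) (.inter C (.compl D)) x = 0) ∧
    (∀ (C : ALC CN RN) (a : Δ), a ∈ interp cI rI C →
      fmem θ (indA cI) (indR rI) C a = 1) ∧
    (∀ (R : RN) (a b : Δ), (a, b) ∈ rI R → indR rI R a b = 1) := by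
  classical
  have hi : ∀ (C : ALC CN RN) (x : Δ),
      fmem θ (indA cI) (indR rI) C x = 1 ↔ x ∈ interp cI rI C := by
    intro C x
    rw [fmem_eq_ite]
    split_ifs with h <;> simp [h]
  refine ⟨hi, ?_, fun C a h => (hi C a).2 h, ?_⟩
  · intro C D h x
    rw [fmem_eq_ite, if_neg]
    rintro ⟨h1, h2⟩
    exact h2 (h h1)
  · intro R a b h
    simp [indR, h]
end
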